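/- arXiv:1809.07587 — 9 statements merged into one kernel-verified Lean document; each statement's English description precedes it below -/
import Mathlib

section
/- Let μ be a finite Borel measure on ℝ. Then μ has no extended states at zero, i.e. (μ([−ε,ε]) − μ({0}))/ε → 0 as ε → 0⁺, if and only if 𝔰*(t) := ∫_{ℝ∖{0}} t/(λ²+t²) dμ(λ) tends to 0 as t → 0⁺. -/
open MeasureTheory Filter Topology Set

/-- Dyadic majorant of the Poisson-type kernel. -/
lemma ofReal_div_sq_add_sq_le_tsum_indicator {t : ℝ} (ht : 0 < t) (x : ℝ) :
    ENNReal.ofReal (t / (x ^ 2 + t ^ 2)) ≤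
      ∑' k : ℕ, (Icc (-(2 ^ k * t)) (2 ^ k * t)).indicator
        (fun _ => ENNReal.ofReal (4 / (4 ^ k * t))) x := by
  have hex : ∃ k : ℕ, |x| ≤ 2 ^ k * t := by
    obtain ⟨k, hk⟩ := pow_unbounded_of_one_lt (|x| / t) (one_lt_two : (1 : ℝ) < 2)
    exact ⟨k, ((div_lt_iff₀ ht).1 hk).le⟩
  classical
  let k := Nat.find hex
  have hk : |x| ≤ 2 ^ k * t := Nat.find_spec hex
  have hx : x ∈ Icc (-(2 ^ k * t)) (2 ^ k * t) := abs_le.1 hk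
  refine le_trans ?_ (ENNReal.le_tsum k)
  rw [indicator_of_mem hx]
  refine ENNReal.ofReal_le_ofReal ?_
  rw [div_le_div_iff₀ (by positivity) (by positivity)]
  rcases hk0 : k with _ | j
  · nlinarith [sq_nonneg x, sq_nonneg t]
  · have hj : 2 ^ j * t < |x| := by
      have := Nat.find_min hex (show j < Nat.find hex by change j < k; omega)
      exact not_le.1 this
    have hsq : (2 ^ j * t) ^ 2 ≤ x ^ 2 := by
      rw [← sq_abs x]
      gcongr
    have h4 : (4 : ℝ) ^ j = (2 ^ j) ^ 2 := by
      rw [← pow_mul, mul_comm, pow_mul]; norm_num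
    rw [pow_succ, h4]
    nlinarith [sq_nonneg t]

/-- A linear bound on the mass of centred intervals bounds the Stieltjes-type transform. -/
lemma lintegral_ofReal_div_sq_add_sq_le {ν : Measure ℝ} {η : ℝ} (hη : 0 ≤ η)
    (hν : ∀ s : ℝ, 0 < s → ν (Icc (-s) s) ≤ ENNReal.ofReal (η * s)) {t : ℝ} (ht : 0 < t) :
    ∫⁻ x, ENNReal.ofReal (t / (x ^ 2 + t ^ 2)) ∂ν ≤ ENNReal.ofReal (8 * η) := by
  calc ∫⁻ x, ENNReal.ofReal (t / (x ^ 2 + t ^ 2)) ∂ν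
      ≤ ∫⁻ x, ∑' k : ℕ, (Icc (-(2 ^ k * t)) (2 ^ k * t)).indicator
          (fun _ => ENNReal.ofReal (4 / (4 ^ k * t))) x ∂ν :=
        lintegral_mono fun x => ofReal_div_sq_add_sq_le_tsum_indicator ht x
    _ = ∑' k : ℕ, ENNReal.ofReal (4 / (4 ^ k * t)) * ν (Icc (-(2 ^ k * t)) (2 ^ k * t)) := by
        rw [lintegral_tsum fun k =>
          (measurable_const.indicator measurableSet_Icc).aemeasurable]
        simp_rw [lintegral_indicator_const measurableSet_Icc]
    _ ≤ ∑' k : ℕ, ENNReal.ofReal (4 * η * (1 / 2) ^ k) := by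
        refine ENNReal.tsum_le_tsum fun k => ?_
        refine (mul_le_mul_right (hν (2 ^ k * t) (by positivity)) _).trans_eq ?_
        rw [← ENNReal.ofReal_mul (by positivity)]
        congr 1
        have h4 : (4 : ℝ) ^ k = 2 ^ k * 2 ^ k := by rw [← mul_pow]; norm_num
        rw [h4, one_div, inv_pow]
        field_simp
    _ = ENNReal.ofReal (8 * η) := by
        rw [← ENNReal.ofReal_tsum_of_nonneg (fun k => by positivity)
          (summable_geometric_two.mul_left _), tsum_mul_left, tsum_geometric_two]
        congr 1
        ring

/-- The mass of a punctured interval is controlled by the Stieltjes-type transform. -/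
lemma measure_punctured_Icc_div_le (μ : Measure ℝ) {t : ℝ} (ht : 0 < t) :
    ENNReal.ofReal (1 / (2 * t)) * μ (Icc (-t) t \ {0}) ≤
      ∫⁻ x in ({0}ᶜ : Set ℝ), ENNReal.ofReal (t / (x ^ 2 + t ^ 2)) ∂μ := by
  have hmeas : MeasurableSet (Icc (-t) t \ {0}) :=
    measurableSet_Icc.diff (measurableSet_singleton 0)
  rw [← setLIntegral_const]
  refine (setLIntegral_mono' hmeas fun x hx => ENNReal.ofReal_le_ofReal ?_).trans
    (lintegral_mono_set fun x hx => hx.2)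
  have hsq : x ^ 2 ≤ t ^ 2 := sq_le_sq' hx.1.1 hx.1.2
  rw [div_le_div_iff₀ (by positivity) (by positivity)]
  nlinarith

/-- A finite Borel measure `μ` on `ℝ` has no extended states at zero,
i.e. `(μ([−ε,ε]) − μ({0}))/ε → 0` as `ε → 0⁺`, if and only if
`𝔰*(t) = ∫_{ℝ∖{0}} t/(λ²+t²) dμ(λ) → 0` as `t → 0⁺`. -/
theorem stmt_0 (μ : Measure ℝ) [IsFiniteMeasure μ] :
    Tendsto (fun ε : ℝ => (μ (Set.Icc (-ε) ε \ {0})).toReal / ε) (𝓝[>] 0) (𝓝 0) ↔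
    Tendsto (fun t : ℝ => ∫⁻ x in ({0}ᶜ : Set ℝ), ENNReal.ofReal (t / (x ^ 2 + t ^ 2)) ∂μ)
      (𝓝[>] 0) (𝓝 0) := by
  constructor
  · intro h
    rw [ENNReal.tendsto_nhds_zero]
    intro e he
    rcases eq_or_ne e ⊤ with rfl | hetop
    · exact Eventually.of_forall fun _ => le_top
    have hc : 0 < e.toReal := ENNReal.toReal_pos he.ne' hetop
    set c := e.toReal with hcdef
    have hev : ∀ᶠ s : ℝ in 𝓝[>] 0, (μ (Icc (-s) s \ {0})).toReal / s < c / 16 :=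
      h.eventually (gt_mem_nhds (by positivity))
    obtain ⟨d, hd, hds⟩ := mem_nhdsGT_iff_exists_Ioc_subset.1 hev
    have hd : 0 < d := hd
    have hbound : ∀ s : ℝ, 0 < s → s ≤ d →
        μ (Icc (-s) s \ {0}) ≤ ENNReal.ofReal (c / 16 * s) := by
      intro s hs hsd
      rw [ENNReal.le_ofReal_iff_toReal_le (measure_ne_top _ _) (by positivity)]
      have hlt : (μ (Icc (-s) s \ {0})).toReal / s < c / 16 := hds ⟨hs, hsd⟩
      exact ((div_lt_iff₀ hs).1 hlt).le
    have hnear : ∀ s : ℝ, 0 < s →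
        μ.restrict (Icc (-d) d \ {0}) (Icc (-s) s) ≤ ENNReal.ofReal (c / 16 * s) := by
      intro s hs
      rw [Measure.restrict_apply measurableSet_Icc]
      rcases le_total s d with hsd | hsd
      · exact (measure_mono fun x hx => And.intro hx.1 hx.2.2).trans (hbound s hs hsd)
      · exact (measure_mono inter_subset_right).trans
          ((hbound d hd le_rfl).trans (ENNReal.ofReal_le_ofReal (by gcongr)))
    have hfar : ∀ᶠ t : ℝ in 𝓝[>] 0, t / d ^ 2 * (μ univ).toReal < c / 2 := by
      have hlim : Tendsto (fun t : ℝ => t / d ^ 2 * (μ univ).toReal) (𝓝[>] 0) (𝓝 0) := by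
        have hcont : Continuous fun t : ℝ => t / d ^ 2 * (μ univ).toReal := by fun_prop
        simpa using (hcont.tendsto 0).mono_left nhdsWithin_le_nhds
      exact hlim.eventually (gt_mem_nhds (by positivity))
    filter_upwards [hfar, self_mem_nhdsWithin] with t htfar ht
    have ht : 0 < t := ht
    have hcover : ({0}ᶜ : Set ℝ) ⊆ (Icc (-d) d \ {0}) ∪ (Icc (-d) d)ᶜ := by
      intro x hx
      by_cases hxd : x ∈ Icc (-d) d
      · exact Or.inl ⟨hxd, hx⟩
      · exact Or.inr hxd
    have hfar' : ∫⁻ x in (Icc (-d) d)ᶜ, ENNReal.ofReal (t / (x ^ 2 + t ^ 2)) ∂μ ≤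
        ENNReal.ofReal (c / 2) := by
      calc ∫⁻ x in (Icc (-d) d)ᶜ, ENNReal.ofReal (t / (x ^ 2 + t ^ 2)) ∂μ
          ≤ ∫⁻ _ in (Icc (-d) d)ᶜ, ENNReal.ofReal (t / d ^ 2) ∂μ := by
            refine setLIntegral_mono' measurableSet_Icc.compl fun x hx =>
              ENNReal.ofReal_le_ofReal ?_
            have hdx : d < |x| := not_le.1 fun hle => hx (abs_le.1 hle)
            have hsq : d ^ 2 ≤ x ^ 2 := by
              rw [← sq_abs x]
              gcongr
            gcongr
            nlinarith [sq_nonneg t]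
        _ ≤ ENNReal.ofReal (t / d ^ 2) * μ univ := by
            rw [setLIntegral_const]
            gcongr
            exact subset_univ _
        _ = ENNReal.ofReal (t / d ^ 2 * (μ univ).toReal) := by
            rw [ENNReal.ofReal_mul (by positivity), ENNReal.ofReal_toReal (measure_ne_top _ _)]
        _ ≤ ENNReal.ofReal (c / 2) := ENNReal.ofReal_le_ofReal htfar.le
    calc ∫⁻ x in ({0}ᶜ : Set ℝ), ENNReal.ofReal (t / (x ^ 2 + t ^ 2)) ∂μ
        ≤ ENNReal.ofReal (8 * (c / 16)) + ENNReal.ofReal (c / 2) :=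
          (lintegral_mono_set hcover).trans <| (lintegral_union_le _ _ _).trans <|
            add_le_add (lintegral_ofReal_div_sq_add_sq_le (by positivity) hnear ht) hfar'
      _ = e := by
          rw [← ENNReal.ofReal_add (by positivity) (by positivity),
            show 8 * (c / 16) + c / 2 = c by ring, hcdef, ENNReal.ofReal_toReal hetop]
  · intro h
    have h2 := (ENNReal.tendsto_toReal ENNReal.zero_ne_top).comp h
    have h3 := h2.const_mul 2
    rw [ENNReal.toReal_zero, mul_zero] at h3
    refine tendsto_of_tendsto_of_tendsto_of_le_of_le' tendsto_const_nhds h3 ?_ ?_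
    · filter_upwards [self_mem_nhdsWithin] with t ht
      exact div_nonneg ENNReal.toReal_nonneg (le_of_lt ht)
    · filter_upwards [self_mem_nhdsWithin, h.eventually (gt_mem_nhds ENNReal.zero_lt_top)]
        with t ht hfin
      have ht : 0 < t := ht
      have hle := ENNReal.toReal_mono hfin.ne (measure_punctured_Icc_div_le μ ht)
      rw [ENNReal.toReal_mul, ENNReal.toReal_ofReal (by positivity)] at hle
      calc (μ (Icc (-t) t \ {0})).toReal / t
          = 2 * (1 / (2 * t) * (μ (Icc (-t) t \ {0})).toReal) := by field_simp
        _ ≤ _ := mul_le_mul_of_nonneg_left hle two_pos.le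
end

section
/- For all ε > 0 and t > 0, one has arctan(ε/t) = ∫₀^∞ (2tu/(t²+u²)²) · min(ε, u) du, where the integral is with respect to Lebesgue measure on (0,∞). -/
open MeasureTheory Filter Topology Set

lemma hasDerivAt_neg_mul_div_sq_add_sq (ε u : ℝ) {t : ℝ} (ht : 0 < t) :
    HasDerivAt (fun u : ℝ => -(ε * t) / (t ^ 2 + u ^ 2))
      (2 * t * u / (t ^ 2 + u ^ 2) ^ 2 * ε) u := by
  have hne : t ^ 2 + u ^ 2 ≠ 0 := by positivity
  have h := (hasDerivAt_const u (-(ε * t))).div (((hasDerivAt_id u).pow 2).const_add (t ^ 2)) hne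
  refine h.congr_deriv ?_
  simp
  field_simp

lemma hasDerivAt_arctan_div_sub_mul_div_sq_add_sq (u : ℝ) {t : ℝ} (ht : 0 < t) :
    HasDerivAt (fun u : ℝ => Real.arctan (u / t) - t * u / (t ^ 2 + u ^ 2))
      (2 * t * u / (t ^ 2 + u ^ 2) ^ 2 * u) u := by
  have hne : t ^ 2 + u ^ 2 ≠ 0 := by positivity
  have h := (((hasDerivAt_id u).div_const t).arctan).sub
    (((hasDerivAt_id u).const_mul t).div (((hasDerivAt_id u).pow 2).const_add (t ^ 2)) hne)
  refine h.congr_deriv ?_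
  have h1 : 1 + (u / t) ^ 2 = (t ^ 2 + u ^ 2) / t ^ 2 := by field_simp
  simp [h1]
  field_simp
  ring

lemma tendsto_neg_mul_div_sq_add_sq_atTop (ε t : ℝ) :
    Tendsto (fun u : ℝ => -(ε * t) / (t ^ 2 + u ^ 2)) atTop (𝓝 0) :=
  tendsto_const_nhds.div_atTop
    (tendsto_atTop_add_const_left _ _ (tendsto_pow_atTop two_ne_zero))

/-- For all `ε, t > 0`,
`arctan(ε/t) = ∫₀^∞ (2tu/(t²+u²)²) · min(ε,u) du`,
the integral being w.r.t. Lebesgue measure on `(0,∞)`. -/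
theorem stmt_3 (ε t : ℝ) (hε : 0 < ε) (ht : 0 < t) :
    Real.arctan (ε / t) =
      ∫ u in Set.Ioi (0 : ℝ), 2 * t * u / (t ^ 2 + u ^ 2) ^ 2 * min ε u := by
  have hnear : EqOn (fun u : ℝ => 2 * t * u / (t ^ 2 + u ^ 2) ^ 2 * min ε u)
      (fun u => 2 * t * u / (t ^ 2 + u ^ 2) ^ 2 * u) (Ioc 0 ε) := fun u hu => by
    simp only [min_eq_right hu.2]
  have hfar : EqOn (fun u : ℝ => 2 * t * u / (t ^ 2 + u ^ 2) ^ 2 * min ε u)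
      (fun u => 2 * t * u / (t ^ 2 + u ^ 2) ^ 2 * ε) (Ioi ε) := fun u hu => by
    simp only [min_eq_left (le_of_lt (mem_Ioi.mp hu))]
  have hcont : Continuous fun u : ℝ => 2 * t * u / (t ^ 2 + u ^ 2) ^ 2 * u :=
    ((by fun_prop : Continuous fun u : ℝ => 2 * t * u).div (by fun_prop)
      fun u => by positivity).mul continuous_id
  have hpos : ∀ u ∈ Ioi ε, 0 ≤ 2 * t * u / (t ^ 2 + u ^ 2) ^ 2 * ε := fun u hu => by
    have : 0 < u := hε.trans hu
    positivity
  have hderiv : ∀ u ∈ Ici ε, HasDerivAt (fun u : ℝ => -(ε * t) / (t ^ 2 + u ^ 2))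
      (2 * t * u / (t ^ 2 + u ^ 2) ^ 2 * ε) u :=
    fun u _ => hasDerivAt_neg_mul_div_sq_add_sq ε u ht
  have hlim := tendsto_neg_mul_div_sq_add_sq_atTop ε t
  have hint := hcont.intervalIntegrable (μ := volume) 0 ε
  rw [← Ioc_union_Ioi_eq_Ioi hε.le,
    setIntegral_union (Ioc_disjoint_Ioi le_rfl) measurableSet_Ioi
      ((integrableOn_congr_fun hnear measurableSet_Ioc).mpr hint.1)
      ((integrableOn_congr_fun hfar measurableSet_Ioi).mpr
        (integrableOn_Ioi_deriv_of_nonneg' hderiv hpos hlim)),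
    setIntegral_congr_fun measurableSet_Ioc hnear, setIntegral_congr_fun measurableSet_Ioi hfar,
    integral_Ioi_of_hasDerivAt_of_nonneg' hderiv hpos hlim,
    ← intervalIntegral.integral_of_le hε.le,
    intervalIntegral.integral_eq_sub_of_hasDerivAt
      (fun u _ => hasDerivAt_arctan_div_sub_mul_div_sq_add_sq u ht) hint]
  simp
  ring
end

section
/- Let μ be a finite Borel measure on ℝ. For all ε > 0 and t > 0, one has ∫_{I_ε} t/(λ²+t²) dμ(λ) ≤ (sup_{u ∈ (0,ε]} μ(I_u)/u) · arctan(ε/t), where I_r = [−r, r] ∖ {0}. -/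
open MeasureTheory Filter Topology Set

/-- The integral of the Poisson-type kernel `t / (x² + t²)` over `(0, ε]` is `arctan (ε / t)`. -/
lemma lintegral_Ioc_div_sq_add_sq {ε t : ℝ} (hε : 0 < ε) (ht : 0 < t) :
    ∫⁻ x in Ioc (0 : ℝ) ε, ENNReal.ofReal (t / (x ^ 2 + t ^ 2)) =
      ENNReal.ofReal (Real.arctan (ε / t)) := by
  have hpos : ∀ x : ℝ, 0 < x ^ 2 + t ^ 2 := fun x => by positivity
  have hcont : Continuous fun x : ℝ => t / (x ^ 2 + t ^ 2) :=
    continuous_const.div (by fun_prop) fun x => (hpos x).ne'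
  rw [← ofReal_integral_eq_lintegral_ofReal
      ((intervalIntegrable_iff_integrableOn_Ioc_of_le hε.le).1 (hcont.intervalIntegrable 0 ε))
      (Eventually.of_forall fun x => div_nonneg ht.le (hpos x).le),
    ← intervalIntegral.integral_of_le hε.le]
  have hderiv : ∀ x ∈ uIcc 0 ε,
      HasDerivAt (fun x => Real.arctan (x / t)) (t / (x ^ 2 + t ^ 2)) x := fun x _ => by
    convert ((hasDerivAt_id' x).div_const t).arctan using 1
    have := hpos x
    field_simp
    ring
  rw [intervalIntegral.integral_eq_sub_of_hasDerivAt hderiv (hcont.intervalIntegrable 0 ε)]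
  simp

/-- The superlevel sets of `t / (x² + t²)` in `[-ε, ε] ∖ {0}` have `μ`-measure at most `K` times
the length of their positive part if `μ ([-u, u] ∖ {0}) ≤ K u` for all `u ∈ (0, ε]`. -/
lemma measure_superlevel_div_sq_add_sq_le {μ : Measure ℝ} {K : ENNReal} {ε t s : ℝ}
    (hε : 0 < ε) (ht : 0 < t) (hs : 0 < s)
    (hK : ∀ u ∈ Ioc (0 : ℝ) ε, μ (Icc (-u) u \ {0}) ≤ K * ENNReal.ofReal u) :
    μ ({x | s ≤ t / (x ^ 2 + t ^ 2)} ∩ (Icc (-ε) ε \ {0})) ≤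
      K * volume ({x | s ≤ t / (x ^ 2 + t ^ 2)} ∩ Ioc 0 ε) := by
  have hlevel : ∀ x : ℝ, s ≤ t / (x ^ 2 + t ^ 2) ↔ x ^ 2 ≤ t / s - t ^ 2 := fun x => by
    rw [le_div_iff₀ (by positivity), le_sub_iff_add_le, le_div_iff₀ hs, mul_comm]
  simp only [hlevel]
  rcases le_or_gt (t / s - t ^ 2) 0 with h | h
  · have : {x : ℝ | x ^ 2 ≤ t / s - t ^ 2} ∩ (Icc (-ε) ε \ {0}) = ∅ := by
      ext x
      simp only [mem_inter_iff, mem_ofPred_eq, Set.mem_sdiff, mem_singleton_iff, mem_empty_iff_false,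
        iff_false, not_and, not_not]
      exact fun hx _ => pow_eq_zero_iff two_ne_zero |>.1 (le_antisymm (hx.trans h) (sq_nonneg x))
    simp [this]
  · set m := min (√(t / s - t ^ 2)) ε
    have hm : m ∈ Ioc 0 ε := ⟨lt_min (Real.sqrt_pos.2 h) hε, min_le_right _ _⟩
    calc μ ({x | x ^ 2 ≤ t / s - t ^ 2} ∩ (Icc (-ε) ε \ {0}))
        ≤ μ (Icc (-m) m \ {0}) := by
          refine measure_mono ?_
          rintro x ⟨hx, hxε, hx0⟩
          exact ⟨abs_le.1 (le_min (Real.abs_le_sqrt hx) (abs_le.2 hxε)), hx0⟩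
      _ ≤ K * volume (Ioc 0 m) := by simpa using hK m hm
      _ ≤ _ := by
          gcongr
          rintro x ⟨hx0, hxm⟩
          exact ⟨(Real.le_sqrt hx0.le h.le).1 (hxm.trans (min_le_left _ _)), hx0,
            hxm.trans hm.2⟩

/-- For a finite Borel measure `μ` on `ℝ` and all `ε, t > 0`,
`∫_{I_ε} t/(λ²+t²) dμ(λ) ≤ (sup_{u ∈ (0,ε]} μ(I_u)/u) · arctan(ε/t)`,
where `I_r = [−r,r] ∖ {0}` and the supremum is taken in `[0,∞]`. -/
theorem stmt_4 (μ : Measure ℝ) [IsFiniteMeasure μ] (ε t : ℝ) (hε : 0 < ε) (ht : 0 < t) :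
    ∫⁻ x in (Set.Icc (-ε) ε \ {0}), ENNReal.ofReal (t / (x ^ 2 + t ^ 2)) ∂μ ≤
      (⨆ u ∈ Set.Ioc (0 : ℝ) ε, μ (Set.Icc (-u) u \ {0}) / ENNReal.ofReal u) *
        ENNReal.ofReal (Real.arctan (ε / t)) := by
  set K := ⨆ u ∈ Set.Ioc (0 : ℝ) ε, μ (Set.Icc (-u) u \ {0}) / ENNReal.ofReal u with hKdef
  have hK : ∀ u ∈ Ioc (0 : ℝ) ε, μ (Icc (-u) u \ {0}) ≤ K * ENNReal.ofReal u := fun u hu => by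
    rw [← ENNReal.div_le_iff (ENNReal.ofReal_pos.2 hu.1).ne' ENNReal.ofReal_ne_top]
    exact le_iSup₂ (f := fun u (_ : u ∈ Ioc (0 : ℝ) ε) =>
      μ (Icc (-u) u \ {0}) / ENNReal.ofReal u) u hu
  have hnn : ∀ x : ℝ, 0 ≤ t / (x ^ 2 + t ^ 2) := fun x => by positivity
  have hmeas : Measurable fun x : ℝ => t / (x ^ 2 + t ^ 2) := by fun_prop
  have hlevel : ∀ s : ℝ, MeasurableSet {x : ℝ | s ≤ t / (x ^ 2 + t ^ 2)} :=
    fun s => measurableSet_le measurable_const hmeas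
  rw [← lintegral_Ioc_div_sq_add_sq hε ht, ← smul_eq_mul, ← lintegral_smul_measure,
    lintegral_eq_lintegral_meas_le _ (Eventually.of_forall hnn) hmeas.aemeasurable,
    lintegral_eq_lintegral_meas_le _ (Eventually.of_forall hnn) hmeas.aemeasurable]
  refine setLIntegral_mono' measurableSet_Ioi fun s hs => ?_
  rw [Measure.smul_apply, Measure.restrict_apply (hlevel s), Measure.restrict_apply (hlevel s)]
  exact measure_superlevel_div_sq_add_sq_le hε ht hs hK
end

section
/- Let μ be a finite Borel measure on ℝ. For all ε > 0 and t > 0, one has ∫_{ℝ∖{0}} t/(λ²+t²) dμ(λ) ≤ (t/ε²)·μ(ℝ) + (π/2)·sup_{u ∈ (0,ε]} μ(I_u)/u, where I_r = [−r, r] ∖ {0}. -/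
open MeasureTheory Filter Topology Set

theorem setLIntegral_Ioc_ofReal_eq_sub {F f : ℝ → ℝ} {a b : ℝ} (hab : a ≤ b)
    (hF : ∀ u, HasDerivAt F (f u) u) (hf : Continuous f) (h0 : ∀ u ∈ Ioc a b, 0 ≤ f u) :
    ∫⁻ u in Ioc a b, ENNReal.ofReal (f u) = ENNReal.ofReal (F b - F a) := by
  rw [← intervalIntegral.integral_eq_sub_of_hasDerivAt (fun u _ => hF u)
    (hf.intervalIntegrable a b), intervalIntegral.integral_of_le hab,
    ofReal_integral_eq_lintegral_ofReal]
  · exact (hf.intervalIntegrable a b).1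
  · exact (ae_restrict_iff' measurableSet_Ioc).2 (ae_of_all _ h0)

theorem hasDerivAt_neg_poisson {t : ℝ} (ht : 0 < t) (u : ℝ) :
    HasDerivAt (fun u : ℝ => -(t / (u ^ 2 + t ^ 2))) (2 * t * u / (u ^ 2 + t ^ 2) ^ 2) u := by
  have h : u ^ 2 + t ^ 2 ≠ 0 := by positivity
  refine (((hasDerivAt_const u t).div
    (((hasDerivAt_id' u).pow 2).add_const (t ^ 2)) h).neg).congr_deriv ?_
  simp
  ring

theorem hasDerivAt_arctan_sub_poisson {t : ℝ} (ht : 0 < t) (u : ℝ) :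
    HasDerivAt (fun u : ℝ => Real.arctan (u / t) - u * (t / (u ^ 2 + t ^ 2)))
      (2 * t * u / (u ^ 2 + t ^ 2) ^ 2 * u) u := by
  have h : u ^ 2 + t ^ 2 ≠ 0 := by positivity
  have h2 : 1 + (u / t) ^ 2 = (u ^ 2 + t ^ 2) / t ^ 2 := by
    field_simp
    ring
  have hF : (fun u : ℝ => Real.arctan (u / t) - u * (t / (u ^ 2 + t ^ 2))) =
      fun u => Real.arctan (u / t) + u * -(t / (u ^ 2 + t ^ 2)) := by
    ext v
    ring
  rw [hF]
  refine ((((hasDerivAt_id' u).div_const t).arctan).add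
    ((hasDerivAt_id' u).mul (hasDerivAt_neg_poisson ht u))).congr_deriv ?_
  rw [h2]
  field_simp
  ring

theorem continuous_poisson_deriv {t : ℝ} (ht : 0 < t) :
    Continuous fun u : ℝ => 2 * t * u / (u ^ 2 + t ^ 2) ^ 2 :=
  Continuous.div (by fun_prop) (by fun_prop) fun u => by positivity

theorem poisson_le_add_lintegral {ε t : ℝ} (hε : 0 < ε) (ht : 0 < t) (x : ℝ) :
    ENNReal.ofReal (t / (x ^ 2 + t ^ 2)) ≤ ENNReal.ofReal (t / ε ^ 2) +
      ∫⁻ u in Ioc 0 ε, {p : ℝ × ℝ | |p.1| ≤ p.2}.indicator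
        (fun p => ENNReal.ofReal (2 * t * p.2 / (p.2 ^ 2 + t ^ 2) ^ 2)) (x, u) := by
  rcases le_total ε |x| with hx | hx
  · refine le_add_right (ENNReal.ofReal_le_ofReal ?_)
    have : ε ^ 2 ≤ x ^ 2 := by rw [← sq_abs x]; gcongr
    gcongr
    nlinarith
  · have hε' : t / (ε ^ 2 + t ^ 2) ≤ t / ε ^ 2 := by
      gcongr
      nlinarith
    calc ENNReal.ofReal (t / (x ^ 2 + t ^ 2))
        ≤ ENNReal.ofReal (t / ε ^ 2 +
            (-(t / (ε ^ 2 + t ^ 2)) - -(t / (|x| ^ 2 + t ^ 2)))) := by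
          apply ENNReal.ofReal_le_ofReal
          rw [sq_abs]
          linarith
      _ ≤ _ := ENNReal.ofReal_add_le
      _ = ENNReal.ofReal (t / ε ^ 2) +
            ∫⁻ u in Ioc |x| ε, ENNReal.ofReal (2 * t * u / (u ^ 2 + t ^ 2) ^ 2) := by
          rw [setLIntegral_Ioc_ofReal_eq_sub hx (hasDerivAt_neg_poisson ht)
            (continuous_poisson_deriv ht)]
          intro u hu
          have : 0 ≤ u := (abs_nonneg x).trans hu.1.le
          positivity
      _ = ENNReal.ofReal (t / ε ^ 2) +
            ∫⁻ u in Ioc |x| ε, {p : ℝ × ℝ | |p.1| ≤ p.2}.indicator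
              (fun p => ENNReal.ofReal (2 * t * p.2 / (p.2 ^ 2 + t ^ 2) ^ 2)) (x, u) := by
          congr 1
          refine setLIntegral_congr_fun measurableSet_Ioc fun u hu => ?_
          rw [indicator_of_mem]
          exact hu.1.le
      _ ≤ _ := by
          gcongr
          exact abs_nonneg x

theorem lintegral_poisson_deriv_mul_le {ε t : ℝ} (hε : 0 < ε) (ht : 0 < t) :
    ∫⁻ u in Ioc 0 ε, ENNReal.ofReal (2 * t * u / (u ^ 2 + t ^ 2) ^ 2 * u) ≤
      ENNReal.ofReal (Real.pi / 2) := by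
  rw [setLIntegral_Ioc_ofReal_eq_sub hε.le (hasDerivAt_arctan_sub_poisson ht)
    ((continuous_poisson_deriv ht).mul continuous_id)]
  · apply ENNReal.ofReal_le_ofReal
    have h1 := Real.arctan_lt_pi_div_two (ε / t)
    have h2 : 0 ≤ ε * (t / (ε ^ 2 + t ^ 2)) := by positivity
    simp only [zero_div, Real.arctan_zero, zero_mul, sub_zero]
    linarith
  · intro u hu
    have := hu.1
    positivity

/-- For a finite Borel measure `μ` on `ℝ` and all `ε, t > 0`,
`∫_{ℝ∖{0}} t/(λ²+t²) dμ(λ) ≤ (t/ε²)·μ(ℝ) + (π/2)·sup_{u ∈ (0,ε]} μ(I_u)/u`,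
where `I_r = [−r,r] ∖ {0}` and the supremum is taken in `[0,∞]`. -/
theorem stmt_5 (μ : Measure ℝ) [IsFiniteMeasure μ] (ε t : ℝ) (hε : 0 < ε) (ht : 0 < t) :
    ∫⁻ x in ({0}ᶜ : Set ℝ), ENNReal.ofReal (t / (x ^ 2 + t ^ 2)) ∂μ ≤
      ENNReal.ofReal (t / ε ^ 2) * μ Set.univ +
        ENNReal.ofReal (Real.pi / 2) *
          ⨆ u ∈ Set.Ioc (0 : ℝ) ε, μ (Set.Icc (-u) u \ {0}) / ENNReal.ofReal u := by
  set S := ⨆ u ∈ Set.Ioc (0 : ℝ) ε, μ (Set.Icc (-u) u \ {0}) / ENNReal.ofReal u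
  have hmeas : Measurable ({p : ℝ × ℝ | |p.1| ≤ p.2}.indicator
      (fun p => ENNReal.ofReal (2 * t * p.2 / (p.2 ^ 2 + t ^ 2) ^ 2))) :=
    Measurable.indicator (by fun_prop)
      (isClosed_le (by fun_prop) (by fun_prop)).measurableSet
  have hinner : ∀ u ∈ Ioc 0 ε, ∫⁻ x in ({0}ᶜ : Set ℝ), {p : ℝ × ℝ | |p.1| ≤ p.2}.indicator
      (fun p => ENNReal.ofReal (2 * t * p.2 / (p.2 ^ 2 + t ^ 2) ^ 2)) (x, u) ∂μ ≤
      S * ENNReal.ofReal (2 * t * u / (u ^ 2 + t ^ 2) ^ 2 * u) := by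
    intro u hu
    have hu0 : 0 < u := hu.1
    have hle : μ (Icc (-u) u \ {0}) ≤ S * ENNReal.ofReal u := by
      rw [← ENNReal.div_le_iff (by simpa using hu0) ENNReal.ofReal_ne_top]
      exact le_iSup₂ (f := fun u (_ : u ∈ Ioc (0 : ℝ) ε) =>
        μ (Icc (-u) u \ {0}) / ENNReal.ofReal u) u hu
    have heq : (fun x : ℝ => {p : ℝ × ℝ | |p.1| ≤ p.2}.indicator
        (fun p => ENNReal.ofReal (2 * t * p.2 / (p.2 ^ 2 + t ^ 2) ^ 2)) (x, u)) =
        (Icc (-u) u).indicator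
          fun _ => ENNReal.ofReal (2 * t * u / (u ^ 2 + t ^ 2) ^ 2) := by
      ext x
      simp only [indicator_apply, mem_ofPred_eq, mem_Icc, abs_le]
    rw [heq, lintegral_indicator_const measurableSet_Icc, Measure.restrict_apply measurableSet_Icc,
      ← sdiff_eq, ENNReal.ofReal_mul (by positivity), mul_left_comm]
    gcongr
  calc ∫⁻ x in ({0}ᶜ : Set ℝ), ENNReal.ofReal (t / (x ^ 2 + t ^ 2)) ∂μ
      ≤ ∫⁻ x in ({0}ᶜ : Set ℝ), (ENNReal.ofReal (t / ε ^ 2) +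
          ∫⁻ u in Ioc 0 ε, {p : ℝ × ℝ | |p.1| ≤ p.2}.indicator
            (fun p => ENNReal.ofReal (2 * t * p.2 / (p.2 ^ 2 + t ^ 2) ^ 2)) (x, u)) ∂μ :=
        lintegral_mono (poisson_le_add_lintegral hε ht)
    _ = ENNReal.ofReal (t / ε ^ 2) * μ {0}ᶜ +
          ∫⁻ u in Ioc 0 ε, ∫⁻ x in ({0}ᶜ : Set ℝ), {p : ℝ × ℝ | |p.1| ≤ p.2}.indicator
            (fun p => ENNReal.ofReal (2 * t * p.2 / (p.2 ^ 2 + t ^ 2) ^ 2)) (x, u) ∂μ := by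
        rw [lintegral_add_left measurable_const, setLIntegral_const,
          lintegral_lintegral_swap (f := fun x u => {p : ℝ × ℝ | |p.1| ≤ p.2}.indicator
            (fun p => ENNReal.ofReal (2 * t * p.2 / (p.2 ^ 2 + t ^ 2) ^ 2)) (x, u))
            hmeas.aemeasurable]
    _ ≤ ENNReal.ofReal (t / ε ^ 2) * μ univ +
          ∫⁻ u in Ioc 0 ε, S * ENNReal.ofReal (2 * t * u / (u ^ 2 + t ^ 2) ^ 2 * u) := by
        exact add_le_add (mul_le_mul_right (measure_mono (subset_univ _)) _)
          (setLIntegral_mono' measurableSet_Ioc hinner)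
    _ ≤ _ := by
        rw [lintegral_const_mul _ (by fun_prop), mul_comm S]
        gcongr
        exact lintegral_poisson_deriv_mul_le hε ht
end

section
/- Let π = (π_k)_{k≥0} be a probability distribution on ℕ with mean m ∈ (0,∞) and π₀ + π₁ < 1, and let M(z) = φ(z) + (1−z)φ'(z) + φ(1−φ̂(z)) − 1 on [0,1]. Then every point z ∈ [0,1] at which M attains its maximum over [0,1] satisfies the fixed-point equation z = 1 − φ̂(1 − φ̂(z)). -/
open Filter Topology Set

/-- Generating function `φ(z) = Σ πₖ zᵏ` of a distribution on ℕ. -/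
noncomputable def genFun (p : ℕ → ℝ) (z : ℝ) : ℝ := ∑' k : ℕ, p k * z ^ k

/-- Derivative series `φ'(z) = Σ (k+1) π_{k+1} zᵏ`. -/
noncomputable def genFunD (p : ℕ → ℝ) (z : ℝ) : ℝ :=
  ∑' k : ℕ, ((k : ℝ) + 1) * p (k + 1) * z ^ k

/-- Generating function `φ̂(z) = Σ π̂ₖ zᵏ = φ'(z)/m` of the size-biased distribution
`π̂ₖ = (k+1)π_{k+1}/m`. -/
noncomputable def genFunHat (p : ℕ → ℝ) (m : ℝ) (z : ℝ) : ℝ := genFunD p z / m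

/-- Derivative series `φ̂'(z) = Σ (k+1) π̂_{k+1} zᵏ = Σ (k+1)(k+2) π_{k+2}/m · zᵏ`. -/
noncomputable def genFunHatD (p : ℕ → ℝ) (m : ℝ) (z : ℝ) : ℝ :=
  ∑' k : ℕ, ((k : ℝ) + 1) * (((k : ℝ) + 2) * p (k + 2) / m) * z ^ k

/-- The function `M(z) = φ(z) + (1−z)φ'(z) + φ(1−φ̂(z)) − 1` from
Bordenave–Lelarge–Salez, whose maximum over `[0,1]` equals the spectral mass at zero. -/
noncomputable def Mfun (p : ℕ → ℝ) (m : ℝ) (z : ℝ) : ℝ :=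
  genFun p z + (1 - z) * genFunD p z + genFun p (1 - genFunHat p m z) - 1

/-- Tangent line inequality for powers of nonnegative reals. -/
theorem pow_succ_tangent_le {a b : ℝ} (ha : 0 ≤ a) (hb : 0 ≤ b) (k : ℕ) :
    a ^ (k + 1) + (b - a) * (((k : ℝ) + 1) * a ^ k) ≤ b ^ (k + 1) := by
  induction k with
  | zero => simp
  | succ k ih =>
    have h1 := mul_le_mul_of_nonneg_left ih hb
    have h2 : 0 ≤ ((k : ℝ) + 1) * a ^ k * (b - a) ^ 2 := by positivity
    push_cast
    calc a ^ (k + 1 + 1) + (b - a) * (((k : ℝ) + 1 + 1) * a ^ (k + 1))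
        = b * (a ^ (k + 1) + (b - a) * (((k : ℝ) + 1) * a ^ k))
          - ((k : ℝ) + 1) * a ^ k * (b - a) ^ 2 := by ring
      _ ≤ b * b ^ (k + 1) := by linarith
      _ = b ^ (k + 1 + 1) := by ring

/-- The weights of a summable nonnegative power series stay summable on `[0,1]`. -/
theorem summable_mul_pow_of_mem_Icc {c : ℕ → ℝ} (hc0 : ∀ k, 0 ≤ c k) (hc : Summable c)
    {z : ℝ} (hz : z ∈ Set.Icc (0 : ℝ) 1) : Summable fun k => c k * z ^ k :=
  Summable.of_nonneg_of_le (fun k => mul_nonneg (hc0 k) (pow_nonneg hz.1 k))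
    (fun k => mul_le_of_le_one_right (hc0 k) (pow_le_one₀ hz.1 hz.2)) hc

theorem summable_succ_mul_shift {p : ℕ → ℝ} (hmfin : Summable fun k : ℕ => (k : ℝ) * p k) :
    Summable fun k : ℕ => ((k : ℝ) + 1) * p (k + 1) := by
  simpa using (summable_nat_add_iff 1).2 hmfin

theorem genFun_tangent_le {p : ℕ → ℝ} (hp0 : ∀ k, 0 ≤ p k) (hp : Summable p)
    (hmfin : Summable fun k : ℕ => (k : ℝ) * p k) {a b : ℝ} (ha : a ∈ Set.Icc (0 : ℝ) 1)
    (hb : b ∈ Set.Icc (0 : ℝ) 1) :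
    genFun p a + (b - a) * genFunD p a ≤ genFun p b := by
  have hsa := summable_mul_pow_of_mem_Icc hp0 hp ha
  have hsb := summable_mul_pow_of_mem_Icc hp0 hp hb
  have hsd := summable_mul_pow_of_mem_Icc
    (fun k => mul_nonneg (by positivity) (hp0 (k + 1))) (summable_succ_mul_shift hmfin) ha
  have hsa' := (summable_nat_add_iff 1).2 hsa
  have hsb' := (summable_nat_add_iff 1).2 hsb
  unfold genFun genFunD
  rw [hsa.tsum_eq_zero_add, hsb.tsum_eq_zero_add, add_assoc, ← tsum_mul_left,
    ← hsa'.tsum_add (hsd.mul_left _)]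
  simp only [pow_zero]
  refine add_le_add le_rfl ?_
  refine (hsa'.add (hsd.mul_left _)).tsum_le_tsum (fun k => ?_) hsb'
  have h := mul_le_mul_of_nonneg_left (pow_succ_tangent_le ha.1 hb.1 k) (hp0 (k + 1))
  linarith

theorem strictMonoOn_genFunD {p : ℕ → ℝ} (hp0 : ∀ k, 0 ≤ p k) (hp1 : ∑' k : ℕ, p k = 1)
    (hmfin : Summable fun k : ℕ => (k : ℝ) * p k) (hdeg : p 0 + p 1 < 1) :
    StrictMonoOn (genFunD p) (Set.Icc 0 1) := by
  intro a ha b hb hab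
  have hc0 : ∀ k : ℕ, 0 ≤ ((k : ℝ) + 1) * p (k + 1) :=
    fun k => mul_nonneg (by positivity) (hp0 (k + 1))
  obtain ⟨n, hn⟩ : ∃ n, 0 < p (n + 2) := by
    by_contra! h
    have hz : ∀ k ∉ Finset.range 2, p k = 0 := fun k hk => by
      obtain ⟨n, rfl⟩ := Nat.exists_eq_add_of_le' (not_lt.1 (mt Finset.mem_range.2 hk))
      exact le_antisymm (h n) (hp0 _)
    rw [tsum_eq_sum hz] at hp1
    simp [Finset.sum_range_succ] at hp1
    linarith
  refine Summable.tsum_lt_tsum (i := n + 1)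
    (fun k => mul_le_mul_of_nonneg_left (pow_le_pow_left₀ ha.1 hab.le k) (hc0 k)) ?_
    (summable_mul_pow_of_mem_Icc hc0 (summable_succ_mul_shift hmfin) ha)
    (summable_mul_pow_of_mem_Icc hc0 (summable_succ_mul_shift hmfin) hb)
  exact mul_lt_mul_of_pos_left (pow_lt_pow_left₀ hab ha.1 n.succ_ne_zero)
    (mul_pos (by positivity) hn)

theorem genFunHat_mem_Icc {p : ℕ → ℝ} (hp0 : ∀ k, 0 ≤ p k) {m : ℝ}
    (hm : m = ∑' k : ℕ, (k : ℝ) * p k) (hmpos : 0 < m)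
    (hmfin : Summable fun k : ℕ => (k : ℝ) * p k) {z : ℝ} (hz : z ∈ Set.Icc (0 : ℝ) 1) :
    genFunHat p m z ∈ Set.Icc (0 : ℝ) 1 := by
  have hc0 : ∀ k : ℕ, 0 ≤ ((k : ℝ) + 1) * p (k + 1) :=
    fun k => mul_nonneg (by positivity) (hp0 (k + 1))
  have hs := summable_succ_mul_shift hmfin
  refine ⟨div_nonneg (tsum_nonneg fun k => mul_nonneg (hc0 k) (pow_nonneg hz.1 k)) hmpos.le,
    (div_le_one hmpos).2 ?_⟩
  have hm' : m = ∑' k : ℕ, ((k : ℝ) + 1) * p (k + 1) := by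
    rw [hm, hmfin.tsum_eq_zero_add]
    simp
  rw [hm']
  exact (summable_mul_pow_of_mem_Icc hc0 hs hz).tsum_le_tsum
    (fun k => mul_le_of_le_one_right (hc0 k) (pow_le_one₀ hz.1 hz.2)) hs

/-- Convexity of the generating function bounds the increments of `M` from below. -/
theorem mul_sub_genFunD_le_Mfun_sub {p : ℕ → ℝ} (hp0 : ∀ k, 0 ≤ p k) (hp : Summable p) {m : ℝ}
    (hm : m = ∑' k : ℕ, (k : ℝ) * p k) (hmpos : 0 < m)
    (hmfin : Summable fun k : ℕ => (k : ℝ) * p k) {z w : ℝ} (hz : z ∈ Set.Icc (0 : ℝ) 1)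
    (hw : w ∈ Set.Icc (0 : ℝ) 1) :
    (1 - w - genFunHat p m (1 - genFunHat p m z)) * (genFunD p w - genFunD p z) ≤
      Mfun p m w - Mfun p m z := by
  have hz' := genFunHat_mem_Icc hp0 hm hmpos hmfin hz
  have hw' := genFunHat_mem_Icc hp0 hm hmpos hmfin hw
  have h1 := genFun_tangent_le hp0 hp hmfin hz hw
  have h2 := genFun_tangent_le hp0 hp hmfin (Set.Icc.mem_iff_one_sub_mem.1 hz')
    (Set.Icc.mem_iff_one_sub_mem.1 hw')
  have h3 : (1 - genFunHat p m w - (1 - genFunHat p m z)) * genFunD p (1 - genFunHat p m z) =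
      genFunHat p m (1 - genFunHat p m z) * (genFunD p z - genFunD p w) := by
    simp only [genFunHat]
    ring
  rw [h3] at h2
  unfold Mfun
  linarith

/-- With `π` a probability distribution on ℕ of mean `m ∈ (0,∞)` and
`π₀ + π₁ < 1`, every point `z ∈ [0,1]` at which
`M(z) = φ(z) + (1−z)φ'(z) + φ(1−φ̂(z)) − 1` attains its maximum over `[0,1]`
satisfies the fixed-point equation `z = 1 − φ̂(1 − φ̂(z))`. -/
theorem stmt_11 (p : ℕ → ℝ) (hp0 : ∀ k, 0 ≤ p k) (hp1 : ∑' k : ℕ, p k = 1)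
    (m : ℝ) (hm : m = ∑' k : ℕ, (k : ℝ) * p k) (hmpos : 0 < m)
    (hmfin : Summable fun k : ℕ => (k : ℝ) * p k) (hdeg : p 0 + p 1 < 1) :
    ∀ z ∈ Set.Icc (0 : ℝ) 1, IsMaxOn (Mfun p m) (Set.Icc 0 1) z →
      z = 1 - genFunHat p m (1 - genFunHat p m z) := by
  intro z hz hmax
  have hp : Summable p := by
    by_contra h
    simp [tsum_eq_zero_of_not_summable h] at hp1
  have hu := genFunHat_mem_Icc hp0 hm hmpos hmfin
    (Set.Icc.mem_iff_one_sub_mem.1 (genFunHat_mem_Icc hp0 hm hmpos hmfin hz))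
  set y := genFunHat p m (1 - genFunHat p m z) with hy
  have hw : (z + (1 - y)) / 2 ∈ Set.Icc (0 : ℝ) 1 :=
    ⟨by linarith [hz.1, hu.2], by linarith [hz.2, hu.1]⟩
  have hle := mul_sub_genFunD_le_Mfun_sub hp0 hp hm hmpos hmfin hz hw
  rw [← hy] at hle
  have hM : Mfun p m ((z + (1 - y)) / 2) ≤ Mfun p m z := hmax hw
  have hmono := strictMonoOn_genFunD hp0 hp1 hmfin hdeg
  rcases lt_trichotomy z (1 - y) with h | h | h
  · have h1 := hmono hz hw (by linarith)
    have h2 := mul_pos (show 0 < 1 - (z + (1 - y)) / 2 - y by linarith) (sub_pos.2 h1)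
    linarith
  · exact h
  · have h1 := hmono hw hz (by linarith)
    have h2 := mul_pos_of_neg_of_neg (show 1 - (z + (1 - y)) / 2 - y < 0 by linarith)
      (sub_neg.2 h1)
    linarith
end

section
/- Let π = (π_k)_{k≥0} be a probability distribution on ℕ with mean m ∈ (0,∞) and π₀ + π₁ < 1, let M(z) = φ(z) + (1−z)φ'(z) + φ(1−φ̂(z)) − 1 on [0,1], and let z_* be the unique point of (0,1) with z_* = 1 − φ̂(z_*). Then M'(z_*) = 0 and M''(z_*) = m · φ̂'(z_*) · ((φ̂'(z_*))² − 1); in particular, M''(z_*) is negative, zero, or positive according to whether φ̂'(z_*) < 1, φ̂'(z_*) = 1, or φ̂'(z_*) > 1. -/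
open Filter Topology Set

/-- Coefficients of the term-by-term derivative of a power series. -/
def derivCoeff (a : ℕ → ℝ) (k : ℕ) : ℝ := ((k : ℝ) + 1) * a (k + 1)

/-- A real sequence of at most polynomial growth. -/
def PolyGrowth (a : ℕ → ℝ) : Prop := ∃ (C : ℝ) (d : ℕ), ∀ k : ℕ, |a k| ≤ C * ((k : ℝ) + 1) ^ d

theorem PolyGrowth.derivCoeff {a : ℕ → ℝ} (ha : PolyGrowth a) : PolyGrowth (derivCoeff a) := by
  obtain ⟨C, d, h⟩ := ha
  have hC : 0 ≤ C := by simpa using (abs_nonneg _).trans (h 0)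
  refine ⟨C * 2 ^ d, d + 1, fun k => ?_⟩
  have hk : (0 : ℝ) ≤ (k : ℝ) + 1 := by positivity
  rw [_root_.derivCoeff, abs_mul, abs_of_nonneg hk]
  calc ((k : ℝ) + 1) * |a (k + 1)|
      ≤ ((k : ℝ) + 1) * (C * (2 * ((k : ℝ) + 1)) ^ d) := by
        refine mul_le_mul_of_nonneg_left ((h (k + 1)).trans ?_) hk
        refine mul_le_mul_of_nonneg_left (pow_le_pow_left₀ (by positivity) ?_ d) hC
        push_cast
        linarith [(Nat.cast_nonneg k : (0 : ℝ) ≤ k)]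
    _ = C * 2 ^ d * ((k : ℝ) + 1) ^ (d + 1) := by rw [mul_pow, pow_succ]; ring

theorem PolyGrowth.summable_abs {a : ℕ → ℝ} (ha : PolyGrowth a) {r : ℝ} (hr0 : 0 ≤ r)
    (hr1 : r < 1) : Summable fun k => |a k| * r ^ k := by
  obtain ⟨C, d, h⟩ := ha
  rcases hr0.eq_or_lt with rfl | hr
  · exact summable_of_ne_finset_zero (s := {0}) fun k hk => by
      simp [zero_pow (by simpa using hk : k ≠ 0)]
  have h1 : Summable fun k : ℕ => (k : ℝ) ^ d * r ^ k :=
    summable_pow_mul_geometric_of_norm_lt_one d (by rwa [Real.norm_of_nonneg hr0])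
  have h2 := ((summable_nat_add_iff 1).2 h1).mul_left (C / r)
  refine Summable.of_nonneg_of_le (fun k => by positivity) (fun k => ?_) h2
  calc |a k| * r ^ k ≤ C * ((k : ℝ) + 1) ^ d * r ^ k := by gcongr; exact h k
    _ = C / r * (((k + 1 : ℕ) : ℝ) ^ d * r ^ (k + 1)) := by
      push_cast
      field_simp
      ring

theorem PolyGrowth.summable {a : ℕ → ℝ} (ha : PolyGrowth a) {z : ℝ} (hz : |z| < 1) :
    Summable fun k => a k * z ^ k := by
  refine Summable.of_norm ?_
  simpa [abs_mul] using ha.summable_abs (abs_nonneg z) hz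

theorem PolyGrowth.hasDerivAt_genFun {a : ℕ → ℝ} (ha : PolyGrowth a) {z : ℝ} (hz : |z| < 1) :
    HasDerivAt (genFun a) (genFun (_root_.derivCoeff a) z) z := by
  obtain ⟨r, hzr, hr1⟩ := exists_between hz
  have hr0 : 0 ≤ r := (abs_nonneg z).trans hzr.le
  have hu : Summable fun k : ℕ => |a k| * (k * r ^ (k - 1)) := by
    refine (summable_nat_add_iff 1).1 ((ha.derivCoeff.summable_abs hr0 hr1).congr fun k => ?_)
    have hk : (0 : ℝ) ≤ (k : ℝ) + 1 := by positivity
    simp only [_root_.derivCoeff, abs_mul, abs_of_nonneg hk, Nat.add_sub_cancel]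
    push_cast
    ring
  have key : HasDerivAt (fun y => ∑' k : ℕ, a k * y ^ k)
      (∑' k : ℕ, a k * (k * z ^ (k - 1))) z := by
    refine hasDerivAt_tsum_of_isPreconnected (t := Ioo (-r) r) (y₀ := z) hu isOpen_Ioo
      isPreconnected_Ioo (fun k y _ => (hasDerivAt_pow k y).const_mul (a k)) (fun k y hy => ?_)
      (abs_lt.1 hzr) (ha.summable hz) (abs_lt.1 hzr)
    have hy' : |y| ≤ r := (abs_lt.2 hy).le
    rw [Real.norm_eq_abs, abs_mul, abs_mul, abs_pow, Nat.abs_cast]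
    gcongr
  have hs : Summable fun k : ℕ => a k * (k * z ^ (k - 1)) := by
    refine (summable_nat_add_iff 1).1 ((ha.derivCoeff.summable hz).congr fun k => ?_)
    simp only [_root_.derivCoeff, Nat.add_sub_cancel]
    push_cast
    ring
  rw [hs.tsum_eq_zero_add] at key
  refine key.congr_deriv ?_
  simp only [genFun, _root_.derivCoeff, Nat.add_sub_cancel, Nat.cast_zero, zero_mul, mul_zero,
    zero_add]
  refine tsum_congr fun k => ?_
  push_cast
  ring

theorem genFunD_eq_genFun (p : ℕ → ℝ) : genFunD p = genFun (derivCoeff p) := rfl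

theorem genFunHatD_eq_div (p : ℕ → ℝ) (m z : ℝ) :
    genFunHatD p m z = genFun (derivCoeff (derivCoeff p)) z / m := by
  rw [genFunHatD, genFun, ← tsum_div_const]
  refine tsum_congr fun k => ?_
  simp only [derivCoeff]
  push_cast
  ring

theorem hasDerivAt_genFunHat {p : ℕ → ℝ} (hp : PolyGrowth p) (m : ℝ) {z : ℝ} (hz : |z| < 1) :
    HasDerivAt (genFunHat p m) (genFunHatD p m z) z := by
  rw [genFunHatD_eq_div]
  exact (hp.derivCoeff.hasDerivAt_genFun hz).div_const m

theorem differentiableAt_genFunHatD {p : ℕ → ℝ} (hp : PolyGrowth p) (m : ℝ) {z : ℝ}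
    (hz : |z| < 1) : DifferentiableAt ℝ (genFunHatD p m) z := by
  rw [funext (genFunHatD_eq_div p m)]
  exact (hp.derivCoeff.derivCoeff.hasDerivAt_genFun hz).differentiableAt.div_const m

theorem hasDerivAt_Mfun {p : ℕ → ℝ} (hp : PolyGrowth p) {m : ℝ} (hm : m ≠ 0) {z : ℝ}
    (hz : |z| < 1) (hz' : |1 - genFunHat p m z| < 1) :
    HasDerivAt (Mfun p m)
      (m * genFunHatD p m z * ((1 - z) - genFunHat p m (1 - genFunHat p m z))) z := by
  have h1 := hp.hasDerivAt_genFun hz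
  have h2 : HasDerivAt (genFunD p) _ z := hp.derivCoeff.hasDerivAt_genFun hz
  have h3 := ((hasDerivAt_id z).const_sub 1).mul h2
  have h4 := (hp.hasDerivAt_genFun hz').comp z ((hasDerivAt_genFunHat hp m hz).const_sub 1)
  refine (((h1.add h3).add h4).sub_const 1).congr_deriv ?_
  simp only [genFunHatD_eq_div, genFunHat, genFunD_eq_genFun, id]
  field_simp
  ring

theorem genFunHatD_pos {p : ℕ → ℝ} (hp : PolyGrowth p) (hp0 : ∀ k, 0 ≤ p k)
    (hp1 : ∑' k : ℕ, p k = 1) (hdeg : p 0 + p 1 < 1) {m : ℝ} (hm : 0 < m) {z : ℝ}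
    (hz : z ∈ Ioo (0 : ℝ) 1) : 0 < genFunHatD p m z := by
  obtain ⟨k, hk⟩ : ∃ k, 0 < p (k + 2) := by
    by_contra! h
    have h0 : ∀ k ∉ Finset.range 2, p k = 0 := fun k hk => by
      obtain ⟨j, rfl⟩ := Nat.exists_eq_add_of_le' (not_lt.1 (mt Finset.mem_range.2 hk))
      exact (h j).antisymm (hp0 _)
    rw [tsum_eq_sum h0, Finset.sum_range_succ, Finset.sum_range_one] at hp1
    exact hdeg.ne hp1
  rw [genFunHatD_eq_div]
  refine div_pos ?_ hm
  have hz0 := hz.1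
  refine (hp.derivCoeff.derivCoeff.summable (abs_lt.2 ⟨by linarith [hz.1], hz.2⟩)).tsum_pos
    (fun j => ?_) k ?_
  · have := hp0 (j + 1 + 1)
    simp only [derivCoeff]
    positivity
  · have : 0 < p (k + 1 + 1) := hk
    simp only [derivCoeff]
    positivity

/-- With `π` a probability distribution on ℕ of mean `m ∈ (0,∞)`,
`π₀ + π₁ < 1`, and `z_*` the unique point of `(0,1)` with `z_* = 1 − φ̂(z_*)`, one has
`M'(z_*) = 0` and `M''(z_*) = m · φ̂'(z_*) · ((φ̂'(z_*))² − 1)`; in particular `M''(z_*)`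
is negative, zero, or positive according to whether `φ̂'(z_*) < 1`, `= 1`, or `> 1`. -/
theorem stmt_12 (p : ℕ → ℝ) (hp0 : ∀ k, 0 ≤ p k) (hp1 : ∑' k : ℕ, p k = 1)
    (m : ℝ) (hm : m = ∑' k : ℕ, (k : ℝ) * p k) (hmpos : 0 < m)
    (hmfin : Summable fun k : ℕ => (k : ℝ) * p k) (hdeg : p 0 + p 1 < 1)
    (zs : ℝ) (hzs : zs ∈ Set.Ioo (0 : ℝ) 1) (hfix : zs = 1 - genFunHat p m zs) :
    deriv (Mfun p m) zs = 0 ∧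
      deriv (deriv (Mfun p m)) zs =
        m * genFunHatD p m zs * ((genFunHatD p m zs) ^ 2 - 1) ∧
      (deriv (deriv (Mfun p m)) zs < 0 ↔ genFunHatD p m zs < 1) ∧
      (deriv (deriv (Mfun p m)) zs = 0 ↔ genFunHatD p m zs = 1) ∧
      (0 < deriv (deriv (Mfun p m)) zs ↔ 1 < genFunHatD p m zs) := by
  have hp : PolyGrowth p := by
    have hs : Summable p := by
      by_contra h
      simp [tsum_eq_zero_of_not_summable h] at hp1
    refine ⟨1, 0, fun k => ?_⟩
    rw [abs_of_nonneg (hp0 k), pow_zero, mul_one, ← hp1]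
    exact hs.le_tsum k fun j _ => hp0 j
  have hz : |zs| < 1 := abs_lt.2 ⟨by linarith [hzs.1], hzs.2⟩
  have hz' : |1 - genFunHat p m zs| < 1 := hfix ▸ hz
  have hφ : genFunHat p m (1 - genFunHat p m zs) = 1 - zs := by
    rw [← hfix]
    linarith
  have hD := hasDerivAt_genFunHat hp m hz
  have hev : deriv (Mfun p m) =ᶠ[𝓝 zs] fun z =>
      m * genFunHatD p m z * ((1 - z) - genFunHat p m (1 - genFunHat p m z)) := by
    filter_upwards [continuous_abs.continuousAt.eventually_lt continuousAt_const hz,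
      (hD.continuousAt.const_sub 1).abs.eventually_lt continuousAt_const hz'] with z h h'
    exact (hasDerivAt_Mfun hp hmpos.ne' h h').deriv
  have hD' : HasDerivAt (genFunHat p m) (genFunHatD p m zs) (1 - genFunHat p m zs) := by
    rw [← hfix]
    exact hD
  have hprod := ((differentiableAt_genFunHatD hp m hz).hasDerivAt.const_mul m).mul
    (((hasDerivAt_id zs).const_sub 1).sub (hD'.comp zs (hD.const_sub 1)))
  have h2 : deriv (deriv (Mfun p m)) zs =
      m * genFunHatD p m zs * ((genFunHatD p m zs) ^ 2 - 1) := by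
    rw [hev.deriv_eq]
    refine hprod.deriv.trans ?_
    simp only [Pi.sub_apply, Function.comp_apply, id, hφ]
    ring
  have hpos : 0 < genFunHatD p m zs := genFunHatD_pos hp hp0 hp1 hdeg hmpos hzs
  have hmpos' : 0 < m * genFunHatD p m zs := mul_pos hmpos hpos
  refine ⟨?_, h2, ?_, ?_, ?_⟩
  · rw [(hasDerivAt_Mfun hp hmpos.ne' hz hz').deriv, hφ, sub_self, mul_zero]
  · rw [h2, ← mul_zero (m * genFunHatD p m zs), mul_lt_mul_iff_right₀ hmpos', sub_neg, sq_lt_one_iff₀ hpos.le]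
  · rw [h2, mul_eq_zero_iff_left hmpos'.ne', sub_eq_zero, pow_eq_one_iff_of_nonneg hpos.le two_ne_zero]
  · rw [h2, mul_pos_iff_of_pos_left hmpos', sub_pos, one_lt_sq_iff₀ hpos.le]
end

section
/- Let π = (π_k)_{k≥0} be a probability distribution on ℕ with mean m ∈ (0,∞) and π₀ + π₁ < 1, with generating function φ and size-biased generating function φ̂, and let z_* be the unique point of (0,1) with z_* = 1 − φ̂(z_*). Then for z ∈ [0,1] the following three conditions are equivalent: (a) z = z_*; (b) φ(z) = φ(1 − φ̂(z)); (c) φ̂(z) = φ̂(1 − φ̂(z)). -/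
open Filter Topology Set

/-- A power series with summable nonnegative coefficients converges on `[0, 1]`. -/
lemma summable_mul_pow_of_mem_Icc_s14 {a : ℕ → ℝ} (ha : ∀ k, 0 ≤ a k) (hs : Summable a) {x : ℝ}
    (hx : x ∈ Set.Icc (0 : ℝ) 1) : Summable fun k => a k * x ^ k :=
  hs.of_nonneg_of_le (fun k => mul_nonneg (ha k) (pow_nonneg hx.1 k))
    (fun k => mul_le_of_le_one_right (ha k) (pow_le_one₀ hx.1 hx.2))

/-- A power series with summable nonnegative coefficients, not all of positive degree zero, is
strictly increasing on `[0, 1]`. -/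
lemma strictMonoOn_tsum_mul_pow {a : ℕ → ℝ} (ha : ∀ k, 0 ≤ a k) (hs : Summable a)
    {j : ℕ} (hj : j ≠ 0) (haj : 0 < a j) :
    StrictMonoOn (fun x : ℝ => ∑' k, a k * x ^ k) (Set.Icc 0 1) := by
  intro x hx y hy hxy
  refine Summable.tsum_lt_tsum (i := j)
    (fun k => mul_le_mul_of_nonneg_left (pow_le_pow_left₀ hx.1 hxy.le k) (ha k))
    (mul_lt_mul_of_pos_left (pow_lt_pow_left₀ hxy hx.1 hj) haj)
    (summable_mul_pow_of_mem_Icc_s14 ha hs hx) (summable_mul_pow_of_mem_Icc_s14 ha hs hy)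

/-- A probability distribution on `ℕ` with `p 0 + p 1 < 1` charges some integer `≥ 2`. -/
lemma exists_pos_of_add_lt_one {p : ℕ → ℝ} (hp0 : ∀ k, 0 ≤ p k) (hp1 : ∑' k, p k = 1)
    (hdeg : p 0 + p 1 < 1) : ∃ j, 0 < p (j + 2) := by
  by_contra! h
  have hz : ∀ k ∉ Finset.range 2, p k = 0 := fun k hk => by
    obtain ⟨j, rfl⟩ := Nat.exists_eq_add_of_le' (not_lt.mp (mt Finset.mem_range.mpr hk))
    exact le_antisymm (h j) (hp0 _)
  rw [tsum_eq_sum hz, Finset.sum_range_succ, Finset.sum_range_one] at hp1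
  exact hdeg.ne hp1

/-- With `π` a probability distribution on ℕ of mean `m ∈ (0,∞)`,
`π₀ + π₁ < 1`, and `z_*` the unique point of `(0,1)` with `z_* = 1 − φ̂(z_*)`, for
`z ∈ [0,1]` the conditions `z = z_*`, `φ(z) = φ(1 − φ̂(z))` and
`φ̂(z) = φ̂(1 − φ̂(z))` are equivalent. -/
theorem stmt_14 (p : ℕ → ℝ) (hp0 : ∀ k, 0 ≤ p k) (hp1 : ∑' k : ℕ, p k = 1)
    (m : ℝ) (hm : m = ∑' k : ℕ, (k : ℝ) * p k) (hmpos : 0 < m)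
    (hmfin : Summable fun k : ℕ => (k : ℝ) * p k) (hdeg : p 0 + p 1 < 1)
    (zs : ℝ) (hzs : zs ∈ Set.Ioo (0 : ℝ) 1) (hfix : zs = 1 - genFunHat p m zs) :
    ∀ z ∈ Set.Icc (0 : ℝ) 1,
      (z = zs ↔ genFun p z = genFun p (1 - genFunHat p m z)) ∧
      (z = zs ↔ genFunHat p m z = genFunHat p m (1 - genFunHat p m z)) := by
  have hsum : Summable p := by
    by_contra h
    simp [tsum_eq_zero_of_not_summable h] at hp1
  obtain ⟨j, hj⟩ := exists_pos_of_add_lt_one hp0 hp1 hdeg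
  have hD0 : ∀ k : ℕ, 0 ≤ ((k : ℝ) + 1) * p (k + 1) :=
    fun k => mul_nonneg (by positivity) (hp0 _)
  have hDsum : Summable fun k : ℕ => ((k : ℝ) + 1) * p (k + 1) := by
    simpa using (summable_nat_add_iff 1).mpr hmfin
  have hmono : StrictMonoOn (genFun p) (Set.Icc 0 1) :=
    strictMonoOn_tsum_mul_pow hp0 hsum (Nat.succ_ne_zero (j + 1)) hj
  have hmonoD : StrictMonoOn (genFunD p) (Set.Icc 0 1) :=
    strictMonoOn_tsum_mul_pow hD0 hDsum (Nat.succ_ne_zero j) (mul_pos (by positivity) hj)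
  have hmonoHat : StrictMonoOn (genFunHat p m) (Set.Icc 0 1) :=
    fun x hx y hy hxy => div_lt_div_of_pos_right (hmonoD hx hy hxy) hmpos
  have hone : genFunHat p m 1 = 1 := by
    have h : genFunD p 1 = m := by
      rw [hm, hmfin.tsum_eq_zero_add]
      simp [genFunD]
    rw [genFunHat, h, div_self hmpos.ne']
  have huniq : ∀ z ∈ Set.Icc (0 : ℝ) 1, z = 1 - genFunHat p m z → z = zs := by
    intro z hz h
    have hzs' := Set.Ioo_subset_Icc_self hzs
    rcases lt_trichotomy z zs with hlt | heq | hgt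
    · linarith [hmonoHat hz hzs' hlt]
    · exact heq
    · linarith [hmonoHat hzs' hz hgt]
  intro z hz
  have hmem : 1 - genFunHat p m z ∈ Set.Icc (0 : ℝ) 1 := by
    have hle : genFunHat p m z ≤ 1 :=
      hone ▸ hmonoHat.monotoneOn hz (Set.right_mem_Icc.mpr zero_le_one) hz.2
    have hnonneg : 0 ≤ genFunHat p m z :=
      div_nonneg (tsum_nonneg fun k => mul_nonneg (hD0 k) (pow_nonneg hz.1 k)) hmpos.le
    exact ⟨by linarith, by linarith⟩
  refine ⟨⟨?_, fun h => huniq z hz (hmono.injOn hz hmem h)⟩,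
    ⟨?_, fun h => huniq z hz (hmonoHat.injOn hz hmem h)⟩⟩
  · rintro rfl
    rw [← hfix]
  · rintro rfl
    rw [← hfix]
end

section
/- For c > 0, consider the fixed-point equation q = exp(−c·exp(−c·q)) for q ∈ (0,1). If c ≤ e, this equation has exactly one solution in (0,1); if c > e, it has exactly three solutions in (0,1). Here e = exp(1). -/
open Filter Topology Set

/-- The logarithmic form of the equation `q = exp (-(c * exp (-(c * q))))`. -/
noncomputable def logGap (c q : ℝ) : ℝ := Real.log q + c * Real.exp (-(c * q))

lemma logGap_eq_zero_iff {c q : ℝ} (hq : 0 < q) :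
    logGap c q = 0 ↔ q = Real.exp (-(c * Real.exp (-(c * q)))) := by
  rw [logGap, add_eq_zero_iff_eq_neg, ← Real.exp_eq_exp, Real.exp_log hq]

lemma fixedPoint_mem_Ioo_iff {c q : ℝ} (hc : 0 < c) :
    (q ∈ Ioo (0 : ℝ) 1 ∧ q = Real.exp (-(c * Real.exp (-(c * q))))) ↔
      0 < q ∧ logGap c q = 0 := by
  constructor
  · rintro ⟨h, e⟩
    exact ⟨h.1, (logGap_eq_zero_iff h.1).2 e⟩
  · rintro ⟨h, e⟩
    have e' := (logGap_eq_zero_iff h).1 e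
    refine ⟨⟨h, ?_⟩, e'⟩
    rw [e', Real.exp_lt_one_iff]
    have := mul_pos hc (Real.exp_pos (-(c * q)))
    linarith

lemma hasDerivAt_logGap (c : ℝ) {q : ℝ} (hq : 0 < q) :
    HasDerivAt (logGap c) ((Real.exp (c * q) - c ^ 2 * q) / (q * Real.exp (c * q))) q := by
  have h1 : HasDerivAt (fun x : ℝ => -(c * x)) (-c) q := by
    simpa using ((hasDerivAt_id q).const_mul c).fun_neg
  have h := (Real.hasDerivAt_log hq.ne').add (h1.exp.const_mul c)
  refine h.congr_deriv ?_
  rw [Real.exp_neg]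
  field_simp
  ring

lemma continuousOn_logGap (c : ℝ) {s : Set ℝ} (hs : s ⊆ Ioi 0) : ContinuousOn (logGap c) s :=
  fun _ hx => (hasDerivAt_logGap c (hs hx)).continuousAt.continuousWithinAt

lemma exists_eq_exp_neg_mul {c : ℝ} (hc : 0 < c) : ∃ q : ℝ, 0 < q ∧ q = Real.exp (-(c * q)) := by
  have hcont : ContinuousOn (fun q : ℝ => q - Real.exp (-(c * q))) (Icc 0 1) := by fun_prop
  have hmem : (0 : ℝ) ∈ Icc ((0 : ℝ) - Real.exp (-(c * 0))) (1 - Real.exp (-(c * 1))) := by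
    constructor
    · simp
    · have : Real.exp (-(c * 1)) ≤ 1 := Real.exp_le_one_iff.2 (by linarith)
      linarith
  obtain ⟨q, -, hq⟩ := intermediate_value_Icc zero_le_one hcont hmem
  have hq' : q = Real.exp (-(c * q)) := sub_eq_zero.1 hq
  exact ⟨q, hq' ▸ Real.exp_pos _, hq'⟩

lemma logGap_eq_zero_of_eq_exp_neg_mul {c q : ℝ} (hq : 0 < q) (h : q = Real.exp (-(c * q))) :
    logGap c q = 0 := by
  rw [logGap_eq_zero_iff hq, ← h]
  exact h

lemma logGap_exp_neg_mul_eq_zero {c q : ℝ} (hq : 0 < q) (h : logGap c q = 0) :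
    logGap c (Real.exp (-(c * q))) = 0 := by
  rw [logGap_eq_zero_iff (Real.exp_pos _), ← (logGap_eq_zero_iff hq).1 h]

lemma strictMonoOn_logGap {c : ℝ} (hc : 0 < c) (hce : c ≤ Real.exp 1) :
    StrictMonoOn (logGap c) (Ioi 0) := by
  have hderiv : ∀ q : ℝ, 0 < q → q ≠ c⁻¹ → 0 < deriv (logGap c) q := by
    intro q hq hne
    rw [(hasDerivAt_logGap c hq).deriv]
    apply div_pos _ (mul_pos hq (Real.exp_pos _))
    have hne' : c * q - 1 ≠ 0 := fun h => hne (eq_inv_of_mul_eq_one_right (sub_eq_zero.1 h))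
    have h1 := Real.add_one_lt_exp hne'
    have h2 : Real.exp (c * q) = Real.exp 1 * Real.exp (c * q - 1) := by
      rw [← Real.exp_add]
      ring_nf
    have h3 : c * (c * q) ≤ Real.exp 1 * (c * q) := by gcongr
    have h4 : Real.exp 1 * (c * q) < Real.exp 1 * Real.exp (c * q - 1) := by
      gcongr
      linarith
    nlinarith
  have hpos : 0 < c⁻¹ := inv_pos.2 hc
  have hl : StrictMonoOn (logGap c) (Ioc 0 c⁻¹) := by
    refine strictMonoOn_of_deriv_pos (convex_Ioc _ _) (continuousOn_logGap c fun x hx => hx.1) ?_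
    rw [interior_Ioc]
    exact fun x hx => hderiv x hx.1 hx.2.ne
  have hr : StrictMonoOn (logGap c) (Ici c⁻¹) := by
    refine strictMonoOn_of_deriv_pos (convex_Ici _)
      (continuousOn_logGap c fun x hx => hpos.trans_le hx) ?_
    rw [interior_Ici]
    exact fun x hx => hderiv x (hpos.trans hx) (ne_of_gt hx)
  have := hl.union hr (isGreatest_Ioc hpos) isLeast_Ici
  rwa [Ioc_union_Ici_eq_Ioi hpos] at this

lemma exists_exp_eq_of_logGap_eq {c x y : ℝ} (hx : 0 < x) (hxy : x < y)
    (h : logGap c x = logGap c y) : ∃ z ∈ Ioo x y, Real.exp (c * z) - c ^ 2 * z = 0 := by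
  obtain ⟨z, hz, hz'⟩ := exists_hasDerivAt_eq_zero hxy
    (continuousOn_logGap c fun t ht => hx.trans_le ht.1) h
    (fun t ht => hasDerivAt_logGap c (hx.trans ht.1))
  have hz0 := hx.trans hz.1
  exact ⟨z, hz, (div_eq_zero_iff.1 hz').resolve_right (mul_pos hz0 (Real.exp_pos _)).ne'⟩

lemma exists_mul_exp_eq {c x y : ℝ} (hxy : x < y) (hx : Real.exp (c * x) - c ^ 2 * x = 0)
    (hy : Real.exp (c * y) - c ^ 2 * y = 0) : ∃ z ∈ Ioo x y, c * Real.exp (c * z) = c ^ 2 := by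
  have hd : ∀ t : ℝ, HasDerivAt (fun t : ℝ => Real.exp (c * t) - c ^ 2 * t)
      (c * Real.exp (c * t) - c ^ 2) t := by
    intro t
    have h1 : HasDerivAt (fun t : ℝ => c * t) c t := by
      simpa using (hasDerivAt_id t).const_mul c
    have h2 : HasDerivAt (fun t : ℝ => c ^ 2 * t) (c ^ 2) t := by
      simpa using (hasDerivAt_id t).const_mul (c ^ 2)
    exact (h1.exp.fun_sub h2).congr_deriv (by ring)
  obtain ⟨z, hz, hz'⟩ := exists_hasDerivAt_eq_zero hxy
    (fun t _ => (hd t).continuousAt.continuousWithinAt) (hx.trans hy.symm) (fun t _ => hd t)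
  exact ⟨z, hz, sub_eq_zero.1 hz'⟩

/-- `logGap c` takes no value at four distinct positive points. -/
lemma not_logGap_eq_of_lt {c w x y z : ℝ} (hc : 0 < c) (hw : 0 < w) (hwx : w < x) (hxy : x < y)
    (hyz : y < z) (h₁ : logGap c w = logGap c x) (h₂ : logGap c x = logGap c y)
    (h₃ : logGap c y = logGap c z) : False := by
  obtain ⟨r, hr, hr'⟩ := exists_exp_eq_of_logGap_eq hw hwx h₁
  obtain ⟨s, hs, hs'⟩ := exists_exp_eq_of_logGap_eq (hw.trans hwx) hxy h₂
  obtain ⟨t, ht, ht'⟩ := exists_exp_eq_of_logGap_eq ((hw.trans hwx).trans hxy) hyz h₃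
  obtain ⟨u, hu, hu'⟩ := exists_mul_exp_eq (hr.2.trans hs.1) hr' hs'
  obtain ⟨v, hv, hv'⟩ := exists_mul_exp_eq (hs.2.trans ht.1) hs' ht'
  have h := Real.exp_injective (mul_left_cancel₀ hc.ne' (hu'.trans hv'.symm))
  exact (hu.2.trans hv.1).ne (mul_left_cancel₀ hc.ne' h)

lemma exists_logGap_eq_zero_lt_inv {c : ℝ} (hce : Real.exp 1 < c) :
    ∃ q : ℝ, 0 < q ∧ q < c⁻¹ ∧ logGap c q = 0 := by
  have hc : 0 < c := (Real.exp_pos 1).trans hce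
  have hlt : Real.exp (-c) < c⁻¹ := by
    rw [Real.exp_neg]
    have := Real.add_one_lt_exp hc.ne'
    exact inv_strictAnti₀ hc (by linarith)
  have hneg : logGap c (Real.exp (-c)) < 0 := by
    rw [logGap, Real.log_exp]
    have : Real.exp (-(c * Real.exp (-c))) < 1 :=
      Real.exp_lt_one_iff.2 (neg_neg_of_pos (mul_pos hc (Real.exp_pos _)))
    nlinarith
  have hpos : 0 < logGap c c⁻¹ := by
    rw [logGap, Real.log_inv, mul_inv_cancel₀ hc.ne']
    have h1 : c * Real.exp (-1) ≠ 1 := by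
      rw [Real.exp_neg, ← div_eq_mul_inv]
      exact ((one_lt_div (Real.exp_pos 1)).2 hce).ne'
    have h2 := Real.log_lt_sub_one_of_pos (mul_pos hc (Real.exp_pos (-1))) h1
    rw [Real.log_mul hc.ne' (Real.exp_pos _).ne', Real.log_exp] at h2
    linarith
  obtain ⟨q, hq, hq'⟩ := intermediate_value_Ioo hlt.le
    (continuousOn_logGap c fun x hx => (Real.exp_pos _).trans_le hx.1) ⟨hneg, hpos⟩
  exact ⟨q, (Real.exp_pos _).trans hq.1, hq.2, hq'⟩

lemma inv_lt_of_eq_exp_neg_mul {c q : ℝ} (hce : Real.exp 1 < c) (h : q = Real.exp (-(c * q))) :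
    c⁻¹ < q := by
  have hc : 0 < c := (Real.exp_pos 1).trans hce
  by_contra! hle
  have h1 : c * q ≤ 1 := by
    simpa [hc.ne'] using mul_le_mul_of_nonneg_left hle hc.le
  have h2 : Real.exp (-1) ≤ q := by
    rw [h]
    exact Real.exp_le_exp.2 (by linarith)
  rw [Real.exp_neg] at h2
  exact absurd (h2.trans hle) (not_le.2 (inv_strictAnti₀ (Real.exp_pos 1) hce))

/-- For `c > 0`, the Bauer–Golinelli fixed-point equation
`q = exp(−c·exp(−c·q))` has exactly one solution in `(0,1)` when `c ≤ e`, and exactly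
three solutions in `(0,1)` when `c > e`, where `e = exp 1`. -/
theorem stmt_16 (c : ℝ) (hc : 0 < c) :
    (c ≤ Real.exp 1 →
      ∃! q : ℝ, q ∈ Set.Ioo (0 : ℝ) 1 ∧ q = Real.exp (-(c * Real.exp (-(c * q))))) ∧
    (Real.exp 1 < c →
      ∃ q₁ q₂ q₃ : ℝ, q₁ ≠ q₂ ∧ q₁ ≠ q₃ ∧ q₂ ≠ q₃ ∧
        ∀ q : ℝ,
          (q ∈ Set.Ioo (0 : ℝ) 1 ∧ q = Real.exp (-(c * Real.exp (-(c * q))))) ↔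
            (q = q₁ ∨ q = q₂ ∨ q = q₃)) := by
  simp only [fixedPoint_mem_Ioo_iff hc]
  obtain ⟨q₀, hq₀, hfix⟩ := exists_eq_exp_neg_mul hc
  have hz₀ := logGap_eq_zero_of_eq_exp_neg_mul hq₀ hfix
  refine ⟨fun hce => ⟨q₀, ⟨hq₀, hz₀⟩, fun q hq => ?_⟩, fun hce => ?_⟩
  · exact (strictMonoOn_logGap hc hce).injOn hq.1 hq₀ (hq.2.trans hz₀.symm)
  obtain ⟨q₁, hq₁, hlt, hz₁⟩ := exists_logGap_eq_zero_lt_inv hce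
  have h₁₀ : q₁ < q₀ := hlt.trans (inv_lt_of_eq_exp_neg_mul hce hfix)
  have hz₂ := logGap_exp_neg_mul_eq_zero hq₁ hz₁
  have h₀₂ : q₀ < Real.exp (-(c * q₁)) := by
    conv_lhs => rw [hfix]
    exact Real.exp_lt_exp.2 (neg_lt_neg (mul_lt_mul_of_pos_left h₁₀ hc))
  have hq₂ : 0 < Real.exp (-(c * q₁)) := Real.exp_pos _
  generalize Real.exp (-(c * q₁)) = q₂ at *
  refine ⟨q₁, q₀, q₂, h₁₀.ne, (h₁₀.trans h₀₂).ne, h₀₂.ne, fun q => ⟨?_, ?_⟩⟩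
  · rintro ⟨hq, hz⟩
    by_contra! hne
    obtain ⟨n₁, n₀, n₂⟩ := hne
    rcases n₁.lt_or_gt with h | h
    · exact not_logGap_eq_of_lt hc hq h h₁₀ h₀₂ (by rw [hz, hz₁]) (by rw [hz₁, hz₀])
        (by rw [hz₀, hz₂])
    rcases n₀.lt_or_gt with h' | h'
    · exact not_logGap_eq_of_lt hc hq₁ h h' h₀₂ (by rw [hz, hz₁]) (by rw [hz, hz₀])
        (by rw [hz₀, hz₂])
    rcases n₂.lt_or_gt with h'' | h''
    · exact not_logGap_eq_of_lt hc hq₁ h₁₀ h' h'' (by rw [hz₁, hz₀]) (by rw [hz, hz₀])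
        (by rw [hz, hz₂])
    · exact not_logGap_eq_of_lt hc hq₁ h₁₀ h₀₂ h'' (by rw [hz₁, hz₀]) (by rw [hz₀, hz₂])
        (by rw [hz, hz₂])
  · rintro (rfl | rfl | rfl)
    exacts [⟨hq₁, hz₁⟩, ⟨hq₀, hz₀⟩, ⟨hq₂, hz₂⟩]
end

section
/- Fix c > 0 and let φ(z) = φ̂(z) = exp(c(z−1)), so that M(z) = exp(c(z−1)) + (1−z)·c·exp(c(z−1)) + exp(−c·exp(c(z−1))) − 1 for z ∈ [0,1], and let z_* ∈ (0,1) be the unique point with z_* = 1 − exp(c(z_*−1)). Then M attains its maximum over [0,1] at the single point z_* if and only if c ≤ e, where e = exp(1). -/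
open Filter Topology Set

/-- The function `M` for the Poisson(c) degree distribution, where
`φ(z) = φ̂(z) = exp(c(z−1))`:
`M(z) = exp(c(z−1)) + (1−z)·c·exp(c(z−1)) + exp(−c·exp(c(z−1))) − 1`. -/
noncomputable def MPoisson (c : ℝ) (z : ℝ) : ℝ :=
  Real.exp (c * (z - 1)) + (1 - z) * c * Real.exp (c * (z - 1)) +
    Real.exp (-(c * Real.exp (c * (z - 1)))) - 1

/-- The factor of `M'` that determines its sign. -/
noncomputable def poissonGap (c z : ℝ) : ℝ :=
  1 - z - Real.exp (-(c * Real.exp (c * (z - 1))))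

theorem hasDerivAt_exp_mul_sub_one (c z : ℝ) :
    HasDerivAt (fun z : ℝ => Real.exp (c * (z - 1))) (Real.exp (c * (z - 1)) * c) z := by
  simpa using (((hasDerivAt_id z).sub_const 1).const_mul c).exp

theorem hasDerivAt_poissonGap (c z : ℝ) :
    HasDerivAt (poissonGap c)
      (c * (c * Real.exp (c * (z - 1)) * Real.exp (-(c * Real.exp (c * (z - 1))))) - 1) z := by
  have h := ((hasDerivAt_id z).const_sub 1).sub
    ((hasDerivAt_exp_mul_sub_one c z).const_mul c).neg.exp
  refine h.congr_deriv ?_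
  simp only [Pi.neg_apply]
  ring

theorem hasDerivAt_MPoisson (c z : ℝ) :
    HasDerivAt (MPoisson c) (c ^ 2 * Real.exp (c * (z - 1)) * poissonGap c z) z := by
  have hx := hasDerivAt_exp_mul_sub_one c z
  have h := ((hx.add ((((hasDerivAt_id z).const_sub 1).mul_const c).mul hx)).add
    (hx.const_mul c).neg.exp).sub_const 1
  refine h.congr_deriv ?_
  simp only [poissonGap, id, Pi.neg_apply]
  ring

theorem poissonGap_eq_zero {c z : ℝ} (h : z = 1 - Real.exp (c * (z - 1))) :
    poissonGap c z = 0 := by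
  have hx : Real.exp (c * (z - 1)) = 1 - z := by linarith
  have hx' : -(c * (1 - z)) = c * (z - 1) := by ring
  rw [poissonGap, hx, hx', hx, sub_self]

theorem mul_exp_neg_le (t : ℝ) : t * Real.exp (-t) ≤ Real.exp (-1) := by
  have h := mul_le_mul_of_nonneg_right (Real.add_one_le_exp (t - 1)) (Real.exp_pos (-t)).le
  rw [← Real.exp_add] at h
  ring_nf at h ⊢
  exact h

theorem mul_exp_neg_lt {t : ℝ} (ht : t ≠ 1) : t * Real.exp (-t) < Real.exp (-1) := by
  have h := mul_lt_mul_of_pos_right (Real.add_one_lt_exp (sub_ne_zero.2 ht)) (Real.exp_pos (-t))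
  rw [← Real.exp_add] at h
  ring_nf at h ⊢
  exact h

theorem deriv_poissonGap_neg {c z zs : ℝ} (hc : 0 < c) (hce : c ≤ Real.exp 1)
    (hfix : zs = 1 - Real.exp (c * (zs - 1))) (hz : z ≠ zs) :
    deriv (poissonGap c) z < 0 := by
  rw [(hasDerivAt_poissonGap c z).deriv, sub_neg]
  have he : Real.exp 1 * Real.exp (-1) = 1 := by rw [← Real.exp_add]; simp
  rcases hce.lt_or_eq with hlt | rfl
  · calc _ ≤ c * Real.exp (-1) := mul_le_mul_of_nonneg_left (mul_exp_neg_le _) hc.le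
      _ < Real.exp 1 * Real.exp (-1) := mul_lt_mul_of_pos_right hlt (Real.exp_pos _)
      _ = 1 := he
  · have ht : Real.exp 1 * Real.exp (Real.exp 1 * (z - 1)) ≠ 1 := by
      intro ht
      have hexp : Real.exp (Real.exp 1 * (z - 1)) = Real.exp (-1) :=
        mul_left_cancel₀ hc.ne' (ht.trans he.symm)
      have hlin : Real.exp 1 * (z - 1) = Real.exp 1 * -Real.exp (-1) := by
        rw [Real.exp_injective hexp, mul_neg, he]
      have hzfix : z + Real.exp (Real.exp 1 * (z - 1)) = 1 := by
        have := mul_left_cancel₀ hc.ne' hlin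
        linarith
      have hmono : StrictMono fun y : ℝ => y + Real.exp (Real.exp 1 * (y - 1)) := by
        intro a b hab
        dsimp only
        gcongr
      exact hz (hmono.injective (hzfix.trans (by linarith)))
    calc _ < Real.exp 1 * Real.exp (-1) := mul_lt_mul_of_pos_left (mul_exp_neg_lt ht) hc
      _ = 1 := he

theorem MPoisson_lt {c z zs : ℝ} (hc : 0 < c) (hce : c ≤ Real.exp 1)
    (hfix : zs = 1 - Real.exp (c * (zs - 1))) (hz : z ≠ zs) :
    MPoisson c z < MPoisson c zs := by
  have hcG : Continuous (poissonGap c) :=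
    continuous_iff_continuousAt.2 fun y => (hasDerivAt_poissonGap c y).continuousAt
  have hcM : Continuous (MPoisson c) :=
    continuous_iff_continuousAt.2 fun y => (hasDerivAt_MPoisson c y).continuousAt
  have h0 := poissonGap_eq_zero hfix
  rcases lt_or_gt_of_ne hz with hlt | hgt
  · have hG : StrictAntiOn (poissonGap c) (Iic zs) :=
      strictAntiOn_of_deriv_neg (convex_Iic zs) hcG.continuousOn fun y hy =>
        deriv_poissonGap_neg hc hce hfix (by rw [interior_Iic] at hy; exact hy.ne)
    have hM : StrictMonoOn (MPoisson c) (Iic zs) :=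
      strictMonoOn_of_deriv_pos (convex_Iic zs) hcM.continuousOn fun y hy => by
        rw [interior_Iic] at hy
        have hy0 := hG (mem_Iic.2 (le_of_lt hy)) self_mem_Iic hy
        rw [h0] at hy0
        rw [(hasDerivAt_MPoisson c y).deriv]
        positivity
    exact hM hlt.le self_mem_Iic hlt
  · have hG : StrictAntiOn (poissonGap c) (Ici zs) :=
      strictAntiOn_of_deriv_neg (convex_Ici zs) hcG.continuousOn fun y hy =>
        deriv_poissonGap_neg hc hce hfix (by rw [interior_Ici] at hy; exact hy.ne')
    have hM : StrictAntiOn (MPoisson c) (Ici zs) :=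
      strictAntiOn_of_deriv_neg (convex_Ici zs) hcM.continuousOn fun y hy => by
        rw [interior_Ici] at hy
        have hy0 := hG self_mem_Ici (mem_Ici.2 (le_of_lt hy)) hy
        rw [h0] at hy0
        rw [(hasDerivAt_MPoisson c y).deriv]
        exact mul_neg_of_pos_of_neg (by positivity) hy0
    exact hM self_mem_Ici hgt.le hgt

theorem not_isLocalMax_MPoisson {c zs : ℝ} (hce : Real.exp 1 < c)
    (hfix : zs = 1 - Real.exp (c * (zs - 1))) : ¬ IsLocalMax (MPoisson c) zs := by
  intro hmax
  have hc : 0 < c := (Real.exp_pos 1).trans hce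
  have hx : Real.exp (c * (zs - 1)) = 1 - zs := by linarith
  have ht : 1 < c * (1 - zs) := by
    by_contra! hle
    have h1 : Real.exp (-1) ≤ 1 - zs := by
      rw [← hx]
      exact Real.exp_le_exp.2 (by linarith)
    have h2 : Real.exp 1 * Real.exp (-1) = 1 := by rw [← Real.exp_add]; simp
    have h3 := mul_lt_mul_of_pos_right hce (Real.exp_pos (-1))
    have h4 := mul_le_mul_of_nonneg_left h1 hc.le
    linarith
  have hd : deriv (MPoisson c) = fun z => c ^ 2 * Real.exp (c * (z - 1)) * poissonGap c z :=
    funext fun z => (hasDerivAt_MPoisson c z).deriv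
  have h0 := poissonGap_eq_zero hfix
  have hdd : 0 < deriv (deriv (MPoisson c)) zs := by
    have h := ((hasDerivAt_exp_mul_sub_one c zs).const_mul (c ^ 2)).mul
      (hasDerivAt_poissonGap c zs)
    have hx' : -(c * (1 - zs)) = c * (zs - 1) := by ring
    have h' := h.deriv
    rw [h0, mul_zero, zero_add, hx, hx', hx] at h'
    rw [hd]
    refine lt_of_lt_of_eq ?_ h'.symm
    have hw : 0 < 1 - zs := hx ▸ Real.exp_pos _
    have : 0 < c * (c * (1 - zs) * (1 - zs)) - 1 := by nlinarith
    positivity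
  have hmin := isLocalMin_of_deriv_deriv_pos hdd (by rw [hd]; simp [h0])
    (hasDerivAt_MPoisson c zs).continuousAt
  have hconst : MPoisson c =ᶠ[𝓝 zs] fun _ => MPoisson c zs := by
    filter_upwards [hmax, hmin] with y h1 h2 using le_antisymm h1 h2
  have := hconst.deriv.deriv_eq
  simp at this
  exact hdd.ne' this

/-- For `c > 0` and `z_*` the unique point of `(0,1)` with
`z_* = 1 − exp(c(z_*−1))`, the function `M` attains its maximum over `[0,1]` at the
single point `z_*` if and only if `c ≤ e`, where `e = exp 1`. -/
theorem stmt_17 (c : ℝ) (hc : 0 < c)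
    (zs : ℝ) (hzs : zs ∈ Set.Ioo (0 : ℝ) 1) (hfix : zs = 1 - Real.exp (c * (zs - 1))) :
    (IsMaxOn (MPoisson c) (Set.Icc 0 1) zs ∧
        ∀ z ∈ Set.Icc (0 : ℝ) 1, IsMaxOn (MPoisson c) (Set.Icc 0 1) z → z = zs) ↔
      c ≤ Real.exp 1 := by
  constructor
  · rintro ⟨hmax, -⟩
    by_contra! hce
    exact not_isLocalMax_MPoisson hce hfix (hmax.isLocalMax (Icc_mem_nhds hzs.1 hzs.2))
  · intro hce
    refine ⟨fun z _ => ?_, fun z _ hmax => ?_⟩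
    · rcases eq_or_ne z zs with rfl | hz
      · exact le_refl (MPoisson c z)
      · exact (MPoisson_lt hc hce hfix hz).le
    · by_contra hz
      exact (MPoisson_lt hc hce hfix hz).not_ge (hmax (Ioo_subset_Icc_self hzs))
end
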